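/- arXiv:1102.1173 — 5 statements merged into one kernel-verified Lean document; each statement's English description precedes it below -/
import Mathlib

section
/- For every parameter vector η ∈ ℝ^n with all components positive and every i = 1, …, n, the one-sided limits defining ∂_i⁻F(η) and ∂_i⁺F(η) exist as finite real numbers, and ∂_i⁻F(η) ≥ 0 and ∂_i⁺F(η) ≥ 0. -/
open Filter Set Topology

/-- The value function `F(η) = inf_{x ∈ Q} (φ(x) + Σ_i η_i ψ_i(x))` of
multi-parameter Tikhonov regularization. -/
noncomputable def valueFun {X : Type*} {n : ℕ} (Q : Set X) (φ : X → ℝ)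
    (ψ : Fin n → X → ℝ) (η : Fin n → ℝ) : ℝ :=
  sInf ((fun x => φ x + ∑ i, η i * ψ i x) '' Q)

/-- `HasDPlus F η i D` says that the right-sided partial derivative
`∂_i⁺F(η) = lim_{h→0⁺} (F(η + h eᵢ) - F(η))/h` exists and equals `D`. -/
def HasDPlus {n : ℕ} (F : (Fin n → ℝ) → ℝ) (η : Fin n → ℝ) (i : Fin n) (D : ℝ) : Prop :=
  Filter.Tendsto (fun h : ℝ => (F (η + h • (Pi.single i 1 : Fin n → ℝ)) - F η) / h)
    (nhdsWithin 0 (Set.Ioi 0)) (nhds D)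

/-- `HasDMinus F η i D` says that the left-sided partial derivative
`∂_i⁻F(η) = lim_{h→0⁺} (F(η) - F(η - h eᵢ))/h` exists and equals `D`. -/
def HasDMinus {n : ℕ} (F : (Fin n → ℝ) → ℝ) (η : Fin n → ℝ) (i : Fin n) (D : ℝ) : Prop :=
  Filter.Tendsto (fun h : ℝ => (F η - F (η - h • (Pi.single i 1 : Fin n → ℝ))) / h)
    (nhdsWithin 0 (Set.Ioi 0)) (nhds D)

section ValueFunction

variable {X : Type*} {n : ℕ} {Q : Set X} {φ : X → ℝ} {ψ : Fin n → X → ℝ}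

lemma valueFun_le (hφ : ∀ x, 0 ≤ φ x) (hψ : ∀ i x, 0 ≤ ψ i x) {η : Fin n → ℝ} (hη : 0 ≤ η)
    {x : X} (hx : x ∈ Q) : valueFun Q φ ψ η ≤ φ x + ∑ i, η i * ψ i x := by
  refine csInf_le ⟨0, ?_⟩ (mem_image_of_mem _ hx)
  rintro _ ⟨y, -, rfl⟩
  exact add_nonneg (hφ y) (Finset.sum_nonneg fun i _ => mul_nonneg (hη i) (hψ i y))

lemma le_valueFun (hQ : Q.Nonempty) {η : Fin n → ℝ} {c : ℝ}
    (h : ∀ x ∈ Q, c ≤ φ x + ∑ i, η i * ψ i x) : c ≤ valueFun Q φ ψ η :=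
  le_csInf (hQ.image _) (forall_mem_image.2 h)

lemma monotoneOn_valueFun (hQ : Q.Nonempty) (hφ : ∀ x, 0 ≤ φ x) (hψ : ∀ i x, 0 ≤ ψ i x) :
    MonotoneOn (valueFun Q φ ψ) (Ici 0) := by
  intro a ha b _ hab
  refine le_valueFun hQ fun x hx => (valueFun_le hφ hψ ha hx).trans ?_
  gcongr with i
  · exact hψ i x
  · exact hab i

lemma concaveOn_valueFun (hQ : Q.Nonempty) (hφ : ∀ x, 0 ≤ φ x) (hψ : ∀ i x, 0 ≤ ψ i x) :
    ConcaveOn ℝ (Ici 0) (valueFun Q φ ψ) := by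
  refine ⟨convex_Ici 0, fun a ha b hb s t hs ht hst => le_valueFun hQ fun x hx => ?_⟩
  calc s • valueFun Q φ ψ a + t • valueFun Q φ ψ b
      ≤ s * (φ x + ∑ i, a i * ψ i x) + t * (φ x + ∑ i, b i * ψ i x) :=
        add_le_add (mul_le_mul_of_nonneg_left (valueFun_le hφ hψ ha hx) hs)
          (mul_le_mul_of_nonneg_left (valueFun_le hφ hψ hb hx) ht)
    _ = (s + t) * φ x + ∑ i, (s • a + t • b) i * ψ i x := by
        simp only [Pi.add_apply, Pi.smul_apply, smul_eq_mul, add_mul, mul_add,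
          Finset.sum_add_distrib, Finset.mul_sum, mul_assoc]
        ring
    _ = φ x + ∑ i, (s • a + t • b) i * ψ i x := by rw [hst, one_mul]

end ValueFunction

section PartialDerivative

variable {n : ℕ} {F : (Fin n → ℝ) → ℝ} {η : Fin n → ℝ} {i : Fin n} {D : ℝ}

lemma HasDerivWithinAt.hasDPlus
    (h : HasDerivWithinAt (fun t : ℝ => F (η + t • Pi.single i 1)) D (Ioi 0) 0) :
    HasDPlus F η i D := by
  refine ((hasDerivWithinAt_iff_tendsto_slope' self_notMem_Ioi).1 h).congr fun t => ?_
  simp [slope_def_field]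

lemma HasDerivWithinAt.hasDMinus
    (h : HasDerivWithinAt (fun t : ℝ => F (η + t • Pi.single i 1)) D (Iio 0) 0) :
    HasDMinus F η i D := by
  have hneg : Tendsto (fun t : ℝ => -t) (𝓝[>] 0) (𝓝[<] 0) := by
    simpa using tendsto_neg_nhdsGT (a := (0 : ℝ))
  refine (((hasDerivWithinAt_iff_tendsto_slope' self_notMem_Iio).1 h).comp hneg).congr fun t => ?_
  simp only [Function.comp_apply, slope_def_field, neg_smul, zero_smul, add_zero, sub_zero,
    ← sub_eq_add_neg, div_neg, ← neg_div, neg_sub]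

lemma Pi.add_smul_single_nonneg (hη : 0 ≤ η) {t : ℝ} (ht : -η i ≤ t) :
    0 ≤ η + t • (Pi.single i 1 : Fin n → ℝ) := by
  intro j
  rcases eq_or_ne j i with rfl | hj
  · simpa using neg_le_iff_add_nonneg'.1 ht
  · simpa [hj] using hη j

lemma ConcaveOn.comp_add_smul_single (hF : ConcaveOn ℝ (Ici 0) F) (hη : 0 ≤ η) :
    ConcaveOn ℝ (Ici (-η i)) fun t : ℝ => F (η + t • Pi.single i 1) := by
  refine ⟨convex_Ici _, fun a ha b hb s t hs ht hst => ?_⟩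
  convert hF.2 (Pi.add_smul_single_nonneg hη ha) (Pi.add_smul_single_nonneg hη hb) hs ht hst
    using 2
  rw [smul_add, smul_add, add_add_add_comm, ← add_smul, hst, one_smul, smul_smul, smul_smul,
    ← add_smul, smul_eq_mul, smul_eq_mul]

lemma HasDPlus.nonneg (h : HasDPlus F η i D) (hF : MonotoneOn F (Ici 0)) (hη : 0 ≤ η) :
    0 ≤ D := by
  refine ge_of_tendsto h (eventually_mem_nhdsWithin.mono fun t (ht : 0 < t) => ?_)
  have hstep : (0 : Fin n → ℝ) ≤ t • Pi.single i 1 :=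
    smul_nonneg ht.le (Pi.single_nonneg.2 zero_le_one)
  exact div_nonneg
    (sub_nonneg.2 (hF hη (add_nonneg hη hstep) (le_add_of_nonneg_right hstep))) ht.le

lemma HasDMinus.nonneg (h : HasDMinus F η i D) (hF : MonotoneOn F (Ici 0)) (hη : 0 ≤ η)
    (hηi : 0 < η i) : 0 ≤ D := by
  refine ge_of_tendsto h ?_
  filter_upwards [Ioo_mem_nhdsGT hηi] with t ht
  have hstep : (0 : Fin n → ℝ) ≤ t • Pi.single i 1 :=
    smul_nonneg ht.1.le (Pi.single_nonneg.2 zero_le_one)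
  have hmem : (0 : Fin n → ℝ) ≤ η - t • Pi.single i 1 := by
    simpa [sub_eq_add_neg] using Pi.add_smul_single_nonneg hη (neg_le_neg ht.2.le)
  exact div_nonneg (sub_nonneg.2 (hF hmem hη (sub_le_self _ hstep))) ht.1.le

end PartialDerivative

/-- at any positive parameter vector, both one-sided partial derivatives of
the value function exist (as finite real numbers) and are nonnegative. -/
theorem one_sided_derivatives_exist_nonneg {X : Type*} {n : ℕ} (Q : Set X) (hQ : Q.Nonempty)
    (φ : X → ℝ) (hφ : ∀ x, 0 ≤ φ x)
    (ψ : Fin n → X → ℝ) (hψ : ∀ i x, 0 ≤ ψ i x)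
    (η : Fin n → ℝ) (hη : ∀ i, 0 < η i) (i : Fin n) :
    (∃ D : ℝ, 0 ≤ D ∧ HasDMinus (valueFun Q φ ψ) η i D) ∧
    (∃ D : ℝ, 0 ≤ D ∧ HasDPlus (valueFun Q φ ψ) η i D) := by
  have hη₀ : 0 ≤ η := fun j => (hη j).le
  have hmono := monotoneOn_valueFun hQ hφ hψ
  have hconv := ((concaveOn_valueFun hQ hφ hψ).comp_add_smul_single (i := i) hη₀).neg
  have hmem : (0 : ℝ) ∈ interior (Ici (-η i)) := by simpa using hη i
  have hminus := (hconv.hasDerivWithinAt_leftDeriv_of_mem_interior hmem).neg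
  have hplus := (hconv.hasDerivWithinAt_rightDeriv_of_mem_interior hmem).neg
  rw [neg_neg] at hminus hplus
  exact ⟨⟨_, hminus.hasDMinus.nonneg hmono hη₀ (hη i), hminus.hasDMinus⟩,
    ⟨_, hplus.hasDPlus.nonneg hmono hη₀, hplus.hasDPlus⟩⟩
end

section
/- Under Assumption (A), for every parameter vector η with all components positive the set M_η is nonempty, and for each i = 1, …, n there exist minimizers x_i⁺, x_i⁻ ∈ M_η such that ψ_i(x_i⁺) = ∂_i⁺F(η) and ψ_i(x_i⁻) = ∂_i⁻F(η). -/
open Filter Set Topology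

/-- The set `M_η` of minimizers of the Tikhonov functional `J_η` over `Q`. -/
def minSet {X : Type*} {n : ℕ} (Q : Set X) (φ : X → ℝ) (ψ : Fin n → X → ℝ)
    (η : Fin n → ℝ) : Set X :=
  {x | x ∈ Q ∧ ∀ z ∈ Q, φ x + ∑ i, η i * ψ i x ≤ φ z + ∑ i, η i * ψ i z}

/-- The Tikhonov functional `J_η(x) = φ(x) + Σ_i η_i ψ_i(x)`. -/
def tikhonov {X : Type*} {n : ℕ} (φ : X → ℝ) (ψ : Fin n → X → ℝ) (η : Fin n → ℝ) (x : X) : ℝ :=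
  φ x + ∑ i, η i * ψ i x

theorem tikhonov_add_smul {X : Type*} {n : ℕ} (φ : X → ℝ) (ψ : Fin n → X → ℝ)
    (η v : Fin n → ℝ) (t : ℝ) (x : X) :
    tikhonov φ ψ (η + t • v) x = tikhonov φ ψ η x + t * ∑ i, v i * ψ i x := by
  simp only [tikhonov, Pi.add_apply, Pi.smul_apply, smul_eq_mul, add_mul, Finset.sum_add_distrib,
    Finset.mul_sum, mul_assoc, add_assoc]

theorem tikhonov_nonneg {X : Type*} {n : ℕ} {φ : X → ℝ} (hφ : ∀ x, 0 ≤ φ x)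
    {ψ : Fin n → X → ℝ} (hψ : ∀ i x, 0 ≤ ψ i x) {η : Fin n → ℝ} (hη : ∀ i, 0 < η i) (x : X) :
    0 ≤ tikhonov φ ψ η x :=
  add_nonneg (hφ x) (Finset.sum_nonneg fun i _ => mul_nonneg (hη i).le (hψ i x))

theorem valueFun_eq_of_mem_minSet {X : Type*} {n : ℕ} {Q : Set X} {φ : X → ℝ}
    {ψ : Fin n → X → ℝ} {η : Fin n → ℝ} {x : X} (hx : x ∈ minSet Q φ ψ η) :
    valueFun Q φ ψ η = tikhonov φ ψ η x := by
  refine IsLeast.csInf_eq ⟨⟨x, hx.1, rfl⟩, ?_⟩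
  rintro _ ⟨z, hz, rfl⟩
  exact hx.2 z hz

/-- Asymptotic lower bounds add up. -/
theorem eventually_lt_add {f g : ℕ → ℝ} {A B : ℝ} (hf : ∀ a < A, ∀ᶠ k in atTop, a < f k)
    (hg : ∀ b < B, ∀ᶠ k in atTop, b < g k) :
    ∀ a < A + B, ∀ᶠ k in atTop, a < f k + g k := by
  intro a ha
  filter_upwards [hf (A - (A + B - a) / 2) (by linarith),
    hg (B - (A + B - a) / 2) (by linarith)] with k h1 h2
  linarith

theorem eventually_lt_sum {ι : Type*} (s : Finset ι) {g : ι → ℕ → ℝ} {L : ι → ℝ}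
    (hg : ∀ i, ∀ a < L i, ∀ᶠ k in atTop, a < g i k) :
    ∀ a < ∑ i ∈ s, L i, ∀ᶠ k in atTop, a < ∑ i ∈ s, g i k := by
  classical
  induction s using Finset.induction_on with
  | empty =>
    intro a ha
    exact Eventually.of_forall fun _ => by simpa using ha
  | insert i s hi ih =>
    simp only [Finset.sum_insert hi]
    exact eventually_lt_add (hg i) ih

/-- If two sequences are asymptotically bounded below by `A` and `B`, and their sum tends to a
number at most `A + B`, then the first sequence tends to `A`. -/
theorem tendsto_of_eventually_lt_of_tendsto_add {f g : ℕ → ℝ} {A B S : ℝ}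
    (hf : ∀ a < A, ∀ᶠ k in atTop, a < f k) (hg : ∀ b < B, ∀ᶠ k in atTop, b < g k)
    (hS : Tendsto (fun k => f k + g k) atTop (𝓝 S)) (hSAB : S ≤ A + B) :
    Tendsto f atTop (𝓝 A) := by
  refine tendsto_order.2 ⟨hf, fun a ha => ?_⟩
  filter_upwards [hg (B - (a - A) / 2) (by linarith),
    hS.eventually_lt_const (show S < A + B + (a - A) / 2 by linarith)] with k h1 h2
  linarith

/-- A minimizing sequence has a subsequence along which the penalties converge to their values
at a minimizer. -/
theorem exists_mem_minSet_tendsto {X : Type*} [TopologicalSpace X] {n : ℕ} {Q : Set X}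
    {φ : X → ℝ} (hφ : ∀ x, 0 ≤ φ x) {ψ : Fin n → X → ℝ} (hψ : ∀ i x, 0 ≤ ψ i x)
    (hcpt : ∀ u : ℕ → X, (∀ k, u k ∈ Q) →
      (∃ C : ℝ, ∀ k, φ (u k) ≤ C ∧ ∀ i, ψ i (u k) ≤ C) →
      ∃ xs ∈ Q, ∃ σ : ℕ → ℕ, StrictMono σ ∧ Tendsto (u ∘ σ) atTop (𝓝 xs))
    (hlscφ : ∀ (u : ℕ → X) (x : X), (∀ k, u k ∈ Q) → x ∈ Q → Tendsto u atTop (𝓝 x) →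
      φ x ≤ liminf (fun k => φ (u k)) atTop)
    (hlscψ : ∀ (i : Fin n) (u : ℕ → X) (x : X), (∀ k, u k ∈ Q) → x ∈ Q →
      Tendsto u atTop (𝓝 x) → ψ i x ≤ liminf (fun k => ψ i (u k)) atTop)
    {η : Fin n → ℝ} (hη : ∀ i, 0 < η i) {u : ℕ → X} (hu : ∀ k, u k ∈ Q) {m : ℝ}
    (hm : ∀ z ∈ Q, m ≤ tikhonov φ ψ η z)
    (hum : Tendsto (fun k => tikhonov φ ψ η (u k)) atTop (𝓝 m)) :
    ∃ x ∈ minSet Q φ ψ η, ∃ σ : ℕ → ℕ, StrictMono σ ∧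
      ∀ i, Tendsto (fun k => ψ i (u (σ k))) atTop (𝓝 (ψ i x)) := by
  obtain ⟨C, hC⟩ := hum.bddAbove_range
  have hC' : ∀ k, tikhonov φ ψ η (u k) ≤ C := fun k => hC ⟨k, rfl⟩
  have hC0 : 0 ≤ C := (tikhonov_nonneg hφ hψ hη _).trans (hC' 0)
  have hdiv : ∀ i ∈ Finset.univ, 0 ≤ C / η i := fun i _ => div_nonneg hC0 (hη i).le
  have hbdd : ∀ k, φ (u k) ≤ C + ∑ i, C / η i ∧ ∀ i, ψ i (u k) ≤ C + ∑ i, C / η i := by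
    intro k
    have hk := hC' k
    have hnn : ∀ i ∈ Finset.univ, 0 ≤ η i * ψ i (u k) :=
      fun i _ => mul_nonneg (hη i).le (hψ i _)
    unfold tikhonov at hk
    refine ⟨by linarith [Finset.sum_nonneg hnn, Finset.sum_nonneg hdiv], fun i => ?_⟩
    have h1 := Finset.single_le_sum hnn (Finset.mem_univ i)
    have h2 := Finset.single_le_sum hdiv (Finset.mem_univ i)
    have h3 : ψ i (u k) ≤ C / η i := by
      rw [le_div_iff₀ (hη i)]
      linarith [hφ (u k), mul_comm (ψ i (u k)) (η i)]
    linarith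
  obtain ⟨x, hxQ, σ, hσ, hx⟩ := hcpt u hu ⟨_, hbdd⟩
  have hlow : ∀ f : X → ℝ, (∀ y, 0 ≤ f y) → f x ≤ liminf (fun k => f ((u ∘ σ) k)) atTop →
      ∀ a < f x, ∀ᶠ k in atTop, a < f (u (σ k)) := fun f hf0 hf a ha =>
    eventually_lt_of_lt_liminf (ha.trans_le hf)
      (isBoundedUnder_of ⟨0, fun k => hf0 _⟩)
  have hφl := hlow φ hφ (hlscφ (u ∘ σ) x (fun k => hu _) hxQ hx)
  have hψl : ∀ i, ∀ a < η i * ψ i x, ∀ᶠ k in atTop, a < η i * ψ i (u (σ k)) := by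
    intro i a ha
    filter_upwards [hlow (ψ i) (hψ i) (hlscψ i (u ∘ σ) x (fun k => hu _) hxQ hx) (a / η i)
      (by rwa [div_lt_iff₀' (hη i)])] with k hk
    rwa [div_lt_iff₀' (hη i)] at hk
  have hlim : Tendsto (fun k => tikhonov φ ψ η (u (σ k))) atTop (𝓝 m) :=
    hum.comp hσ.tendsto_atTop
  have hxm : tikhonov φ ψ η x ≤ m := by
    refine le_of_forall_lt fun a ha => ?_
    obtain ⟨b, hab, hb⟩ := exists_between ha
    refine hab.trans_le (ge_of_tendsto hlim ?_)
    filter_upwards [eventually_lt_add hφl (eventually_lt_sum Finset.univ hψl) b hb] with k hk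
    exact hk.le
  refine ⟨x, ⟨hxQ, fun z hz => hxm.trans (hm z hz)⟩, σ, hσ, fun i => ?_⟩
  have hsplit : ∀ y, tikhonov φ ψ η y =
      η i * ψ i y + (φ y + ∑ j ∈ Finset.univ.erase i, η j * ψ j y) := by
    intro y
    rw [tikhonov, ← Finset.add_sum_erase _ _ (Finset.mem_univ i)]
    ring
  have key := tendsto_of_eventually_lt_of_tendsto_add (hψl i)
    (eventually_lt_add hφl (eventually_lt_sum (Finset.univ.erase i) hψl))
    (by simpa only [hsplit] using hlim) (by rw [← hsplit]; exact hm x hxQ)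
  simpa only [inv_mul_cancel_left₀ (hη i).ne'] using key.const_mul (η i)⁻¹

/-- A function on `[0, δ)` with supergradients `p t` at all `t ∈ (0, δ)`, and supergradient `L`
at `0` which is a limit of some `p (t k)` with `t k → 0`, has right derivative `L` at `0`. -/
theorem tendsto_slope_of_supergradient {G p : ℝ → ℝ} {δ L : ℝ}
    (hG : ∀ s ∈ Ico 0 δ, ∀ t ∈ Ioo 0 δ, G s ≤ G t + (s - t) * p t)
    (hL : ∀ s ∈ Ioo 0 δ, G s ≤ G 0 + s * L) {t : ℕ → ℝ} (ht : ∀ k, t k ∈ Ioo 0 δ)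
    (hpt : Tendsto (fun k => p (t k)) atTop (𝓝 L)) :
    Tendsto (fun s => (G s - G 0) / s) (𝓝[>] 0) (𝓝 L) := by
  have hδ : 0 < δ := (ht 0).1.trans (ht 0).2
  refine tendsto_order.2 ⟨fun a ha => ?_, fun a ha => ?_⟩
  · obtain ⟨k, hk⟩ := (hpt.eventually_const_lt ha).exists
    filter_upwards [Ioo_mem_nhdsGT (ht k).1] with s hs
    have hsδ : s < δ := hs.2.trans (ht k).2
    have h1 := hG s ⟨hs.1.le, hsδ⟩ _ (ht k)
    have h2 := hG _ ⟨(ht k).1.le, (ht k).2⟩ s ⟨hs.1, hsδ⟩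
    have h3 := hG 0 ⟨le_rfl, hδ⟩ s ⟨hs.1, hsδ⟩
    have h4 : p (t k) ≤ p s := by
      have := sub_pos.2 hs.2
      refine le_of_mul_le_mul_left ?_ this
      linarith
    rw [lt_div_iff₀ hs.1]
    have := mul_lt_mul_of_pos_right (hk.trans_le h4) hs.1
    linarith
  · filter_upwards [Ioo_mem_nhdsGT hδ] with s hs
    refine lt_of_le_of_lt ?_ ha
    rw [div_le_iff₀ hs.1]
    linarith [hL s hs]

/-- The one-sided directional derivative of the value function in direction `v` is attained by
the directional penalty `Σ_i v_i ψ_i` at some minimizer. -/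
theorem exists_mem_minSet_tendsto_slope {X : Type*} [TopologicalSpace X] {n : ℕ} {Q : Set X}
    (hQ : Q.Nonempty)
    {φ : X → ℝ} (hφ : ∀ x, 0 ≤ φ x) {ψ : Fin n → X → ℝ} (hψ : ∀ i x, 0 ≤ ψ i x)
    (hcpt : ∀ u : ℕ → X, (∀ k, u k ∈ Q) →
      (∃ C : ℝ, ∀ k, φ (u k) ≤ C ∧ ∀ i, ψ i (u k) ≤ C) →
      ∃ xs ∈ Q, ∃ σ : ℕ → ℕ, StrictMono σ ∧ Tendsto (u ∘ σ) atTop (𝓝 xs))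
    (hlscφ : ∀ (u : ℕ → X) (x : X), (∀ k, u k ∈ Q) → x ∈ Q → Tendsto u atTop (𝓝 x) →
      φ x ≤ liminf (fun k => φ (u k)) atTop)
    (hlscψ : ∀ (i : Fin n) (u : ℕ → X) (x : X), (∀ k, u k ∈ Q) → x ∈ Q →
      Tendsto u atTop (𝓝 x) → ψ i x ≤ liminf (fun k => ψ i (u k)) atTop)
    {η : Fin n → ℝ} (hη : ∀ i, 0 < η i) (v : Fin n → ℝ) :
    ∃ x ∈ minSet Q φ ψ η,
      Tendsto (fun h : ℝ => (valueFun Q φ ψ (η + h • v) - valueFun Q φ ψ η) / h) (𝓝[>] 0)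
        (𝓝 (∑ i, v i * ψ i x)) := by
  have hne : ∀ ξ : Fin n → ℝ, (∀ i, 0 < ξ i) → (minSet Q φ ψ ξ).Nonempty := by
    intro ξ hξ
    have hbb : BddBelow (tikhonov φ ψ ξ '' Q) :=
      ⟨0, by rintro _ ⟨z, -, rfl⟩; exact tikhonov_nonneg hφ hψ hξ z⟩
    obtain ⟨w, -, hw, hwQ⟩ := exists_seq_tendsto_sInf (hQ.image _) hbb
    choose u hu huw using hwQ
    obtain ⟨x, hx, -⟩ := exists_mem_minSet_tendsto hφ hψ hcpt hlscφ hlscψ hξ hu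
      (fun z hz => csInf_le hbb ⟨z, hz, rfl⟩) (by simpa only [huw] using hw)
    exact ⟨x, hx⟩
  have hev : ∀ᶠ t : ℝ in 𝓝[>] 0, ∀ i, 0 < (η + t • v) i := by
    refine nhdsWithin_le_nhds (eventually_all.2 fun i => ?_)
    have hc : Continuous fun t : ℝ => (η + t • v) i := by
      simp only [Pi.add_apply, Pi.smul_apply, smul_eq_mul]
      fun_prop
    exact hc.continuousAt.eventually_const_lt (by simpa using hη i)
  obtain ⟨δ, hδ, hδv⟩ := mem_nhdsGT_iff_exists_Ioc_subset.1 hev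
  have hδ0 : 0 < δ := hδ
  have hmin : ∀ t : ℝ, ∃ x, t ∈ Icc 0 δ → x ∈ minSet Q φ ψ (η + t • v) := by
    intro t
    by_cases ht : t ∈ Icc 0 δ
    · obtain ⟨x, hx⟩ := hne (η + t • v) (by
        rcases ht.1.eq_or_lt with rfl | h0
        · simpa using hη
        · exact hδv ⟨h0, ht.2⟩)
      exact ⟨x, fun _ => hx⟩
    · exact ⟨hQ.some, fun h => absurd h ht⟩
  choose x hx using hmin
  have hx0 : x 0 ∈ minSet Q φ ψ η := by simpa using hx 0 ⟨le_rfl, hδ0.le⟩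
  obtain ⟨t, -, ht, ht0⟩ := exists_seq_strictAnti_tendsto' hδ0
  have hxt : ∀ k, x (t k) ∈ minSet Q φ ψ (η + t k • v) :=
    fun k => hx _ ⟨(ht k).1.le, (ht k).2.le⟩
  have hlim : Tendsto (fun k => tikhonov φ ψ η (x (t k))) atTop (𝓝 (tikhonov φ ψ η (x 0))) := by
    have hup : Tendsto (fun k => (tikhonov φ ψ η (x 0) + t k * ∑ i, v i * ψ i (x 0)) /
        (1 - t k / δ)) atTop (𝓝 (tikhonov φ ψ η (x 0))) := by
      have h := ((ht0.mul_const (∑ i, v i * ψ i (x 0))).const_add (tikhonov φ ψ η (x 0))).div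
        ((ht0.div_const δ).const_sub 1) (by simp)
      simpa [Pi.div_def] using h
    refine tendsto_of_tendsto_of_tendsto_of_le_of_le tendsto_const_nhds hup
      (fun k => hx0.2 _ (hxt k).1) fun k => ?_
    have hlt : t k / δ < 1 := (div_lt_one hδ0).2 (ht k).2
    change _ ≤ _ / _
    rw [le_div_iff₀ (sub_pos.2 hlt)]
    have h1 : tikhonov φ ψ (η + t k • v) (x (t k)) ≤ tikhonov φ ψ (η + t k • v) (x 0) :=
      (hxt k).2 _ hx0.1
    have h2 := tikhonov_nonneg hφ hψ (hδv ⟨hδ0, le_rfl⟩) (x (t k))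
    have h3 := mul_nonneg (div_nonneg (ht k).1.le hδ0.le) h2
    rw [tikhonov_add_smul] at h3
    rw [tikhonov_add_smul, tikhonov_add_smul] at h1
    have h4 : t k / δ * (tikhonov φ ψ η (x (t k)) + δ * ∑ i, v i * ψ i (x (t k))) =
        t k / δ * tikhonov φ ψ η (x (t k)) + t k * ∑ i, v i * ψ i (x (t k)) := by
      field_simp
    linarith
  obtain ⟨y, hy, σ, -, hσ⟩ := exists_mem_minSet_tendsto hφ hψ hcpt hlscφ hlscψ hη
    (fun k => (hxt k).1) hx0.2 hlim
  have hsuper : ∀ s ∈ Ico 0 δ, ∀ r, ∀ z ∈ minSet Q φ ψ (η + r • v),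
      valueFun Q φ ψ (η + s • v) ≤
        valueFun Q φ ψ (η + r • v) + (s - r) * ∑ i, v i * ψ i z := by
    intro s hs r z hz
    have hxs := hx s ⟨hs.1, hs.2.le⟩
    have h : tikhonov φ ψ (η + s • v) (x s) ≤ tikhonov φ ψ (η + s • v) z := hxs.2 z hz.1
    rw [valueFun_eq_of_mem_minSet hxs, valueFun_eq_of_mem_minSet hz]
    refine h.trans_eq ?_
    rw [tikhonov_add_smul, tikhonov_add_smul]
    ring
  refine ⟨y, hy, ?_⟩
  have key := tendsto_slope_of_supergradient (G := fun s => valueFun Q φ ψ (η + s • v))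
    (p := fun s => ∑ i, v i * ψ i (x s)) (L := ∑ i, v i * ψ i y) (t := fun k => t (σ k))
    (fun s hs r hr => hsuper s hs r _ (hx r ⟨hr.1.le, hr.2.le⟩))
    (fun s hs => by simpa using hsuper s ⟨hs.1.le, hs.2⟩ 0 y (by simpa using hy))
    (fun k => ht _) (tendsto_finsetSum _ fun i _ => (hσ i).const_mul (v i))
  simpa using key

/-- under Assumption (A) (sequential compactness of sublevel sequences and
sequential lower semicontinuity of `φ` and the `ψ i`), for every positive parameter
vector the minimizer set `M_η` is nonempty, and for each `i` there are minimizers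
`x_i⁺, x_i⁻ ∈ M_η` with `ψ i x_i⁺ = ∂_i⁺F(η)` and `ψ i x_i⁻ = ∂_i⁻F(η)`. -/
theorem minimizers_attaining_one_sided_derivatives
    {X : Type*} [TopologicalSpace X] {n : ℕ} (Q : Set X) (hQ : Q.Nonempty)
    (φ : X → ℝ) (hφ : ∀ x, 0 ≤ φ x)
    (ψ : Fin n → X → ℝ) (hψ : ∀ i x, 0 ≤ ψ i x)
    -- Assumption (A)(i): sequential compactness
    (hcpt : ∀ u : ℕ → X, (∀ k, u k ∈ Q) →
      (∃ C : ℝ, ∀ k, φ (u k) ≤ C ∧ ∀ i, ψ i (u k) ≤ C) →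
      ∃ xs ∈ Q, ∃ σ : ℕ → ℕ, StrictMono σ ∧
        Filter.Tendsto (u ∘ σ) Filter.atTop (nhds xs))
    -- Assumption (A)(ii): sequential lower semicontinuity
    (hlscφ : ∀ (u : ℕ → X) (x : X), (∀ k, u k ∈ Q) → x ∈ Q →
      Filter.Tendsto u Filter.atTop (nhds x) →
      φ x ≤ Filter.liminf (fun k => φ (u k)) Filter.atTop)
    (hlscψ : ∀ (i : Fin n) (u : ℕ → X) (x : X), (∀ k, u k ∈ Q) → x ∈ Q →
      Filter.Tendsto u Filter.atTop (nhds x) →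
      ψ i x ≤ Filter.liminf (fun k => ψ i (u k)) Filter.atTop)
    (η : Fin n → ℝ) (hη : ∀ i, 0 < η i) :
    (minSet Q φ ψ η).Nonempty ∧
    ∀ i : Fin n,
      (∃ xp ∈ minSet Q φ ψ η, HasDPlus (valueFun Q φ ψ) η i (ψ i xp)) ∧
      (∃ xm ∈ minSet Q φ ψ η, HasDMinus (valueFun Q φ ψ) η i (ψ i xm)) := by
  have hdir := exists_mem_minSet_tendsto_slope hQ hφ hψ hcpt hlscφ hlscψ hη
  refine ⟨?_, fun i => ⟨?_, ?_⟩⟩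
  · obtain ⟨x, hx, -⟩ := hdir 0
    exact ⟨x, hx⟩
  · obtain ⟨x, hx, h⟩ := hdir (Pi.single i 1)
    refine ⟨x, hx, ?_⟩
    simpa [HasDPlus, Pi.single_apply] using h
  · obtain ⟨x, hx, h⟩ := hdir (-Pi.single i 1)
    refine ⟨x, hx, ?_⟩
    have h' := h.neg
    simp only [← neg_div, neg_sub, smul_neg, ← sub_eq_add_neg] at h'
    simpa [HasDMinus, Pi.single_apply] using h'
end

section
/- Suppose Assumptions (A) and (B) hold and that K is injective. Let δ_n > 0 be a sequence of noise levels with δ_n → 0, with corresponding data y_n satisfying φ(x†, y_n) = δ_n², parameter vectors η(δ_n) = (η_1(δ_n), η_2(δ_n)) with positive components satisfying the discrepancy equation φ(x_{η(δ_n)}^{δ_n}, y_n) = c_m δ_n², where x_{η(δ_n)}^{δ_n} is a minimizer of x ↦ φ(x, y_n) + η_1(δ_n) ψ_1(x) + η_2(δ_n) ψ_2(x) over Q_ad. If there are constants c_0, c_1 > 0 with c_0 ≤ η_1(δ_n)/η_2(δ_n) ≤ c_1 for all n, then x_{η(δ_n)}^{δ_n} converges to x† in the τ-topology as n → ∞.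 -/
open Filter Set Topology

/-- consistency of the discrepancy principle.  Under Assumptions (A) and
(B), if `K` is injective, the parameters `η(δₙ)` satisfy the discrepancy equation
`φ(x_{η(δₙ)}^{δₙ}, yₙ) = c_m δₙ²` and the ratio `η₁(δₙ)/η₂(δₙ)` stays in `[c₀, c₁]`,
then the regularized solutions converge to `x†` in the τ-topology as `δₙ → 0`. -/
theorem discrepancy_principle_consistency
    {X Y : Type*} [NormedAddCommGroup X] [NormedSpace ℝ X] [CompleteSpace X]
    [NormedAddCommGroup Y] [NormedSpace ℝ Y] [CompleteSpace Y]
    (K : X →L[ℝ] Y) (hK : Function.Injective (K : X → Y))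
    (Q : Set X) (hQ : Q.Nonempty) (τ : TopologicalSpace X)
    (φ : X → Y → ℝ) (hφ0 : ∀ x y, 0 ≤ φ x y)
    (ψ₁ ψ₂ : X → ℝ) (hψ₁ : ∀ x, 0 ≤ ψ₁ x) (hψ₂ : ∀ x, 0 ≤ ψ₂ x)
    -- Assumption (B)
    (hB1 : ∀ x y, φ x y = 0 ↔ K x = y)
    (c : ℝ) (hc : 0 < c)
    (hB2 : ∀ x x' y y', K x' = y → φ x y ≤ c * (φ x' y' + φ x y'))
    -- Assumption (A)(i): τ-sequential compactness of sequences with bounded functionals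
    (hcpt : ∀ (u : ℕ → X) (v : ℕ → Y), (∀ k, u k ∈ Q) →
      (∃ C : ℝ, ∀ k, φ (u k) (v k) ≤ C ∧ ψ₁ (u k) ≤ C ∧ ψ₂ (u k) ≤ C) →
      ∃ xs ∈ Q, ∃ σ : ℕ → ℕ, StrictMono σ ∧
        Filter.Tendsto (u ∘ σ) Filter.atTop (@nhds X τ xs))
    -- Assumption (A)(ii): sequential lower semicontinuity along τ-convergent sequences
    (hlscφ : ∀ (y : Y) (u : ℕ → X) (x : X), (∀ k, u k ∈ Q) → x ∈ Q →
      Filter.Tendsto u Filter.atTop (@nhds X τ x) →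
      φ x y ≤ Filter.liminf (fun k => φ (u k) y) Filter.atTop)
    (hlscψ₁ : ∀ (u : ℕ → X) (x : X), (∀ k, u k ∈ Q) → x ∈ Q →
      Filter.Tendsto u Filter.atTop (@nhds X τ x) →
      ψ₁ x ≤ Filter.liminf (fun k => ψ₁ (u k)) Filter.atTop)
    (hlscψ₂ : ∀ (u : ℕ → X) (x : X), (∀ k, u k ∈ Q) → x ∈ Q →
      Filter.Tendsto u Filter.atTop (@nhds X τ x) →
      ψ₂ x ≤ Filter.liminf (fun k => ψ₂ (u k)) Filter.atTop)
    -- exact solution, noise levels and noisy data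
    (xdag : X) (hxdag : xdag ∈ Q)
    (δ : ℕ → ℝ) (hδpos : ∀ m, 0 < δ m)
    (hδ0 : Filter.Tendsto δ Filter.atTop (nhds 0))
    (y : ℕ → Y) (hnoise : ∀ m, φ xdag (y m) = (δ m) ^ 2)
    -- regularization parameters and regularized solutions
    (η₁ η₂ : ℕ → ℝ) (hη₁ : ∀ m, 0 < η₁ m) (hη₂ : ∀ m, 0 < η₂ m)
    (xsol : ℕ → X) (hsolQ : ∀ m, xsol m ∈ Q)
    (hsolmin : ∀ m, ∀ z ∈ Q,
      φ (xsol m) (y m) + η₁ m * ψ₁ (xsol m) + η₂ m * ψ₂ (xsol m) ≤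
        φ z (y m) + η₁ m * ψ₁ z + η₂ m * ψ₂ z)
    -- the discrepancy principle
    (cm : ℝ) (hcm : 1 ≤ cm)
    (hdisc : ∀ m, φ (xsol m) (y m) = cm * (δ m) ^ 2)
    -- ratio bounds
    (c₀ c₁ : ℝ) (hc₀ : 0 < c₀) (hc₁ : 0 < c₁)
    (hratio : ∀ m, c₀ ≤ η₁ m / η₂ m ∧ η₁ m / η₂ m ≤ c₁) :
    Filter.Tendsto xsol Filter.atTop (@nhds X τ xdag) := by
  have hδsq : Tendsto (fun m => (δ m) ^ 2) atTop (nhds 0) := by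
    simpa using hδ0.pow 2
  have hφ_exact : ∀ m, φ (xsol m) (K xdag) ≤ c * (1 + cm) * (δ m) ^ 2 := by
    intro m
    have h := hB2 (xsol m) xdag (K xdag) (y m) rfl
    rw [hnoise, hdisc] at h
    linarith
  have hφ_lim : Tendsto (fun m => φ (xsol m) (K xdag)) atTop (nhds 0) :=
    squeeze_zero (fun m => hφ0 _ _) hφ_exact (by simpa using hδsq.const_mul (c * (1 + cm)))
  have hpenalty : ∀ m, η₁ m / η₂ m * ψ₁ (xsol m) + ψ₂ (xsol m) ≤
      η₁ m / η₂ m * ψ₁ xdag + ψ₂ xdag := by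
    intro m
    have h := hsolmin m xdag hxdag
    rw [hnoise, hdisc] at h
    have hcmδ : (δ m) ^ 2 ≤ cm * (δ m) ^ 2 := le_mul_of_one_le_left (sq_nonneg _) hcm
    have hη : η₁ m / η₂ m * η₂ m = η₁ m := div_mul_cancel₀ _ (hη₂ m).ne'
    refine le_of_mul_le_mul_right ?_ (hη₂ m)
    calc (η₁ m / η₂ m * ψ₁ (xsol m) + ψ₂ (xsol m)) * η₂ m
        = (η₁ m / η₂ m * η₂ m) * ψ₁ (xsol m) + η₂ m * ψ₂ (xsol m) := by ring
      _ ≤ (η₁ m / η₂ m * η₂ m) * ψ₁ xdag + η₂ m * ψ₂ xdag := by rw [hη]; linarith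
      _ = (η₁ m / η₂ m * ψ₁ xdag + ψ₂ xdag) * η₂ m := by ring
  have hψ₂_bound : ∀ m, ψ₂ (xsol m) ≤ c₁ * ψ₁ xdag + ψ₂ xdag := by
    intro m
    have h₁ := mul_nonneg (hc₀.le.trans (hratio m).1) (hψ₁ (xsol m))
    have h₂ := mul_le_mul_of_nonneg_right (hratio m).2 (hψ₁ xdag)
    linarith [hpenalty m]
  have hψ₁_bound : ∀ m, ψ₁ (xsol m) ≤ (c₁ * ψ₁ xdag + ψ₂ xdag) / c₀ := by
    intro m
    rw [le_div_iff₀ hc₀]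
    have h₁ := mul_le_mul_of_nonneg_right (hratio m).1 (hψ₁ (xsol m))
    have h₂ := mul_le_mul_of_nonneg_right (hratio m).2 (hψ₁ xdag)
    linarith [hpenalty m, hψ₂ (xsol m)]
  obtain ⟨B, hB⟩ := hφ_lim.bddAbove_range
  refine tendsto_of_subseq_tendsto fun ns hns => ?_
  obtain ⟨xs, hxs, σ, hσ, hlim⟩ := hcpt (fun k => xsol (ns k)) (fun _ => K xdag)
    (fun k => hsolQ _)
    ⟨max B (max ((c₁ * ψ₁ xdag + ψ₂ xdag) / c₀) (c₁ * ψ₁ xdag + ψ₂ xdag)), fun k =>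
      ⟨(hB (mem_range_self (ns k))).trans (le_max_left _ _),
        (hψ₁_bound _).trans ((le_max_left _ _).trans (le_max_right _ _)),
        (hψ₂_bound _).trans ((le_max_right _ _).trans (le_max_right _ _))⟩⟩
  have hφ_xs := hlscφ (K xdag) _ xs (fun k => hsolQ _) hxs hlim
  have hφ_sub : Tendsto (fun k => φ (xsol (ns (σ k))) (K xdag)) atTop (nhds 0) :=
    hφ_lim.comp (hns.comp hσ.tendsto_atTop)
  have hzero : φ xs (K xdag) = 0 :=
    le_antisymm (hφ_xs.trans_eq hφ_sub.liminf_eq) (hφ0 _ _)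
  obtain rfl : xs = xdag := hK ((hB1 _ _).1 hzero)
  exact ⟨σ, hlim⟩
end

section
/- Under Assumption (A), suppose that for every parameter vector η with all components positive the Tikhonov functional J_η has a unique minimizer x_η over Q_ad, and let T > 0 be a prescribed discrepancy level (T = c_m δ²). If there exist parameter vectors η^a and η^b with all components positive such that φ(x_{η^a}) < T and φ(x_{η^b}) > T, then there exists a parameter vector η* with all components positive such that φ(x_{η*}) = T. -/
open Filter Set Topology

/-- If `η_k → η` in the open positive orthant, then the minimizers `x_{η_k}` are uniformly bounded
in `φ` and in every `ψ_i`. -/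
theorem exists_bound_of_mem_minSet {X : Type*} {n : ℕ} {Q : Set X} (hQ : Q.Nonempty)
    {φ : X → ℝ} (hφ : ∀ x, 0 ≤ φ x) {ψ : Fin n → X → ℝ} (hψ : ∀ i x, 0 ≤ ψ i x)
    {u : ℕ → Fin n → ℝ} (hu : ∀ k i, 0 < u k i) {η : Fin n → ℝ} (hη : ∀ i, 0 < η i)
    (hlim : Tendsto u atTop (𝓝 η)) {x : ℕ → X} (hx : ∀ k, x k ∈ minSet Q φ ψ (u k)) :
    ∃ C : ℝ, ∀ k, φ (x k) ≤ C ∧ ∀ i, ψ i (x k) ≤ C := by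
  obtain ⟨z, hz⟩ := hQ
  have hcoord : ∀ i, Tendsto (fun k => u k i) atTop (𝓝 (η i)) := tendsto_pi_nhds.1 hlim
  have hJ : Tendsto (fun k => φ z + ∑ i, u k i * ψ i z) atTop (𝓝 (φ z + ∑ i, η i * ψ i z)) :=
    tendsto_const_nhds.add (tendsto_finsetSum _ fun i _ => (hcoord i).mul_const _)
  have hS : Tendsto (fun k => ∑ i, (u k i)⁻¹) atTop (𝓝 (∑ i, (η i)⁻¹)) :=
    tendsto_finsetSum _ fun i _ => (hcoord i).inv₀ (hη i).ne'
  obtain ⟨B, hB⟩ := hJ.bddAbove_range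
  obtain ⟨S, hS⟩ := hS.bddAbove_range
  have hterm : ∀ k i, 0 ≤ u k i * ψ i (x k) := fun k i => mul_nonneg (hu k i).le (hψ i _)
  have hmin : ∀ k, φ (x k) + ∑ i, u k i * ψ i (x k) ≤ B := fun k =>
    ((hx k).2 z hz).trans (hB (mem_range_self k))
  have hφB : ∀ k, φ (x k) ≤ B := fun k => by
    linarith [hmin k, Finset.sum_nonneg fun i (_ : i ∈ Finset.univ) => hterm k i]
  refine ⟨max B (S * B), fun k => ⟨(hφB k).trans (le_max_left _ _), fun i => ?_⟩⟩
  refine le_trans ?_ (le_max_right _ _)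
  have hB0 : 0 ≤ B := (hφ _).trans (hφB k)
  have hi : u k i * ψ i (x k) ≤ B := by
    linarith [hmin k, hφ (x k),
      Finset.single_le_sum (fun j _ => hterm k j) (Finset.mem_univ i)]
  have hiS : (u k i)⁻¹ ≤ S :=
    (Finset.single_le_sum (f := fun j => (u k j)⁻¹) (fun j _ => (inv_pos.2 (hu k j)).le)
      (Finset.mem_univ i)).trans (hS (mem_range_self k))
  calc ψ i (x k) = (u k i)⁻¹ * (u k i * ψ i (x k)) := by
        rw [inv_mul_cancel_left₀ (hu k i).ne']
    _ ≤ S * B := mul_le_mul hiS hi (hterm k i) ((inv_pos.2 (hu k i)).le.trans hiS)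

/-- If minimizers `x_k` of `J_{η_k}` have `φ(x_k) → a`, `ψ_i(x_k) → b_i` with `η_k → η`, and `x`
satisfies the lower bounds `φ(x) ≤ a`, `ψ_i(x) ≤ b_i`, then `x` minimizes `J_η` and `φ(x) = a`. -/
theorem mem_minSet_and_eq_of_tendsto {X : Type*} {n : ℕ} {Q : Set X}
    {φ : X → ℝ} {ψ : Fin n → X → ℝ}
    {u : ℕ → Fin n → ℝ} {η : Fin n → ℝ} (hη : ∀ i, 0 < η i)
    (hlim : Tendsto u atTop (𝓝 η)) {x : ℕ → X} (hx : ∀ k, x k ∈ minSet Q φ ψ (u k))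
    {a : ℝ} {b : Fin n → ℝ} (ha : Tendsto (fun k => φ (x k)) atTop (𝓝 a))
    (hb : ∀ i, Tendsto (fun k => ψ i (x k)) atTop (𝓝 (b i)))
    {y : X} (hy : y ∈ Q) (hya : φ y ≤ a) (hyb : ∀ i, ψ i y ≤ b i) :
    y ∈ minSet Q φ ψ η ∧ φ y = a := by
  have hcoord : ∀ i, Tendsto (fun k => u k i) atTop (𝓝 (η i)) := tendsto_pi_nhds.1 hlim
  have hle : ∀ z ∈ Q, a + ∑ i, η i * b i ≤ φ z + ∑ i, η i * ψ i z := fun z hz =>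
    le_of_tendsto_of_tendsto'
      (ha.add (tendsto_finsetSum _ fun i _ => (hcoord i).mul (hb i)))
      (tendsto_const_nhds.add (tendsto_finsetSum _ fun i _ => (hcoord i).mul_const _))
      fun k => (hx k).2 z hz
  have hsum : ∑ i, η i * ψ i y ≤ ∑ i, η i * b i :=
    Finset.sum_le_sum fun i _ => mul_le_mul_of_nonneg_left (hyb i) (hη i).le
  refine ⟨⟨hy, fun z hz => ?_⟩, ?_⟩
  · linarith [hle z hz]
  · linarith [hle y hy]

/-- Under Assumption (A) and uniqueness of minimizers, `η ↦ φ(x_η)` is continuous on the open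
positive orthant. -/
theorem continuousOn_fidelity_minimizer
    {X : Type*} [TopologicalSpace X] {n : ℕ} {Q : Set X} (hQ : Q.Nonempty)
    {φ : X → ℝ} (hφ : ∀ x, 0 ≤ φ x) {ψ : Fin n → X → ℝ} (hψ : ∀ i x, 0 ≤ ψ i x)
    (hcpt : ∀ u : ℕ → X, (∀ k, u k ∈ Q) →
      (∃ C : ℝ, ∀ k, φ (u k) ≤ C ∧ ∀ i, ψ i (u k) ≤ C) →
      ∃ xs ∈ Q, ∃ σ : ℕ → ℕ, StrictMono σ ∧ Tendsto (u ∘ σ) atTop (𝓝 xs))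
    (hlscφ : ∀ (u : ℕ → X) (x : X), (∀ k, u k ∈ Q) → x ∈ Q →
      Tendsto u atTop (𝓝 x) → φ x ≤ liminf (fun k => φ (u k)) atTop)
    (hlscψ : ∀ (i : Fin n) (u : ℕ → X) (x : X), (∀ k, u k ∈ Q) → x ∈ Q →
      Tendsto u atTop (𝓝 x) → ψ i x ≤ liminf (fun k => ψ i (u k)) atTop)
    {xsel : (Fin n → ℝ) → X}
    (hsel : ∀ η : Fin n → ℝ, (∀ i, 0 < η i) → xsel η ∈ minSet Q φ ψ η)
    (huniq : ∀ η : Fin n → ℝ, (∀ i, 0 < η i) → ∀ x ∈ minSet Q φ ψ η, x = xsel η) :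
    ContinuousOn (fun η => φ (xsel η)) {η | ∀ i, 0 < η i} := by
  rw [continuousOn_iff_continuous_domRestrict, continuous_iff_continuousAt]
  rintro ⟨η, hη⟩
  refine tendsto_of_subseq_tendsto fun v hv => ?_
  have hu : Tendsto (fun k => (v k : Fin n → ℝ)) atTop (𝓝 η) :=
    (continuous_subtype_val.tendsto _).comp hv
  have hx : ∀ k, xsel (v k) ∈ minSet Q φ ψ (v k) := fun k => hsel _ (v k).2
  obtain ⟨C, hC⟩ := exists_bound_of_mem_minSet hQ hφ hψ (fun k => (v k).2) hη hu hx
  obtain ⟨y, hy, σ, hσ, hσy⟩ := hcpt _ (fun k => (hx k).1) ⟨C, hC⟩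
  have hmem : ∀ k, (φ (xsel (v (σ k))), fun i => ψ i (xsel (v (σ k)))) ∈
      Icc (0 : ℝ) C ×ˢ Icc (0 : Fin n → ℝ) (fun _ => C) := fun k =>
    ⟨⟨hφ _, (hC _).1⟩, fun i => hψ i _, (hC _).2⟩
  obtain ⟨⟨a, b⟩, -, τ, hτ, hlim⟩ := (isCompact_Icc.prod isCompact_Icc).tendsto_subseq hmem
  have ha : Tendsto (fun k => φ (xsel (v (σ (τ k))))) atTop (𝓝 a) :=
    (continuous_fst.tendsto _).comp hlim
  have hb : ∀ i, Tendsto (fun k => ψ i (xsel (v (σ (τ k))))) atTop (𝓝 (b i)) :=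
    tendsto_pi_nhds.1 ((continuous_snd.tendsto _).comp hlim)
  have hτy : Tendsto (fun k => xsel (v (σ (τ k)))) atTop (𝓝 y) := hσy.comp hτ.tendsto_atTop
  obtain ⟨hymin, rfl⟩ := mem_minSet_and_eq_of_tendsto hη
    (hu.comp (hσ.comp hτ).tendsto_atTop) (fun k => hx (σ (τ k))) ha hb hy
    ((hlscφ _ y (fun k => (hx _).1) hy hτy).trans_eq ha.liminf_eq)
    (fun i => (hlscψ i _ y (fun k => (hx _).1) hy hτy).trans_eq (hb i).liminf_eq)
  obtain rfl := huniq η hη y hymin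
  exact ⟨σ ∘ τ, ha⟩

/-- under Assumption (A), if `J_η` has a unique minimizer `x_η` for every
positive `η`, and the discrepancy `φ(x_η)` goes below the level `T = c_m δ²` at some
parameter and above it at another, then the discrepancy equation `φ(x_{η*}) = T` has a
solution `η*` with positive components. -/
theorem discrepancy_equation_solvable
    {X : Type*} [TopologicalSpace X] {n : ℕ} (Q : Set X) (hQ : Q.Nonempty)
    (φ : X → ℝ) (hφ : ∀ x, 0 ≤ φ x)
    (ψ : Fin n → X → ℝ) (hψ : ∀ i x, 0 ≤ ψ i x)
    -- Assumption (A)(i): sequential compactness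
    (hcpt : ∀ u : ℕ → X, (∀ k, u k ∈ Q) →
      (∃ C : ℝ, ∀ k, φ (u k) ≤ C ∧ ∀ i, ψ i (u k) ≤ C) →
      ∃ xs ∈ Q, ∃ σ : ℕ → ℕ, StrictMono σ ∧
        Filter.Tendsto (u ∘ σ) Filter.atTop (nhds xs))
    -- Assumption (A)(ii): sequential lower semicontinuity
    (hlscφ : ∀ (u : ℕ → X) (x : X), (∀ k, u k ∈ Q) → x ∈ Q →
      Filter.Tendsto u Filter.atTop (nhds x) →
      φ x ≤ Filter.liminf (fun k => φ (u k)) Filter.atTop)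
    (hlscψ : ∀ (i : Fin n) (u : ℕ → X) (x : X), (∀ k, u k ∈ Q) → x ∈ Q →
      Filter.Tendsto u Filter.atTop (nhds x) →
      ψ i x ≤ Filter.liminf (fun k => ψ i (u k)) Filter.atTop)
    -- for every positive η, J_η has the unique minimizer `xsel η` over Q
    (xsel : (Fin n → ℝ) → X)
    (hsel : ∀ η : Fin n → ℝ, (∀ i, 0 < η i) → xsel η ∈ minSet Q φ ψ η)
    (huniq : ∀ η : Fin n → ℝ, (∀ i, 0 < η i) → ∀ x ∈ minSet Q φ ψ η, x = xsel η)
    -- prescribed discrepancy level T = c_m δ²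
    (T : ℝ) (hT : 0 < T)
    (ηa ηb : Fin n → ℝ) (hηa : ∀ i, 0 < ηa i) (hηb : ∀ i, 0 < ηb i)
    (hbelow : φ (xsel ηa) < T) (habove : T < φ (xsel ηb)) :
    ∃ ηstar : Fin n → ℝ, (∀ i, 0 < ηstar i) ∧ φ (xsel ηstar) = T := by
  have hconv : Convex ℝ {η : Fin n → ℝ | ∀ i, 0 < η i} := by
    simpa [Set.pi] using convex_pi (s := univ) fun (i : Fin n) _ => convex_Ioi (𝕜 := ℝ) (0 : ℝ)
  exact hconv.isPreconnected.intermediate_value hηa hηb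
    (continuousOn_fidelity_minimizer hQ hφ hψ hcpt hlscφ hlscψ hsel huniq)
    ⟨hbelow.le, habove.le⟩
end

section
/- Let γ > 0 and let F be twice continuously differentiable on the open positive quadrant {η ∈ ℝ² : η_1 > 0, η_2 > 0}, and suppose that at every η in this quadrant one has F(η) > 0, ∂_1F(η) > 0, ∂_2F(η) > 0, F(η) − η·∇F(η) > 0, and the Hessian ∇²F(η) is nonsingular. Then for every η in the positive quadrant the following are equivalent: (i) ∇Φ_γ(η) = 0; (ii) ∇Ψ_γ(η) = 0; (iii) γ η_1 ∂_1F(η) = γ η_2 ∂_2F(η) = F(η) − η·∇F(η). In particular, the criteria Φ_γ and Ψ_γ share the same set of critical points, namely the solutions of the balancing system (iii). -/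
open Filter Set Topology

/-- The open positive quadrant in `ℝ²`. -/
def posQuad : Set (ℝ × ℝ) := {p | 0 < p.1 ∧ 0 < p.2}

/-- First partial derivative `∂₁F`. -/
noncomputable def dF1 (F : ℝ × ℝ → ℝ) (p : ℝ × ℝ) : ℝ := fderiv ℝ F p (1, 0)

/-- Second partial derivative `∂₂F`. -/
noncomputable def dF2 (F : ℝ × ℝ → ℝ) (p : ℝ × ℝ) : ℝ := fderiv ℝ F p (0, 1)

/-- The balancing criterion `Φ_γ(η) = c_γ F(η)^{2+γ}/(η₁η₂)`, `c_γ = γ^γ/(γ+2)^{γ+2}`. -/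
noncomputable def PhiCrit (γ : ℝ) (F : ℝ × ℝ → ℝ) (p : ℝ × ℝ) : ℝ :=
  (γ ^ γ / (γ + 2) ^ (γ + 2)) * F p ^ (2 + γ) / (p.1 * p.2)

/-- The balancing criterion `Ψ_γ(η) = (F(η) − η·∇F(η))^γ ∂₁F(η) ∂₂F(η)`
(`= φ(x_η)^γ ψ₁(x_η) ψ₂(x_η)` for the value function of Tikhonov regularization). -/
noncomputable def PsiCrit (γ : ℝ) (F : ℝ × ℝ → ℝ) (p : ℝ × ℝ) : ℝ :=
  (F p - (p.1 * dF1 F p + p.2 * dF2 F p)) ^ γ * dF1 F p * dF2 F p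

theorem isOpen_posQuad : IsOpen posQuad :=
  (isOpen_lt continuous_const continuous_fst).inter (isOpen_lt continuous_const continuous_snd)

theorem clm_prod_eq_zero_iff (L : ℝ × ℝ →L[ℝ] ℝ) : L = 0 ↔ L (1, 0) = 0 ∧ L (0, 1) = 0 := by
  constructor
  · rintro rfl
    simp
  · rintro ⟨h₁, h₂⟩
    ext <;> simp [h₁, h₂]

theorem fderiv_PhiCrit_eq_zero_iff {γ : ℝ} (hγ : 0 < γ) {F : ℝ × ℝ → ℝ} {η : ℝ × ℝ}
    (hη : η ∈ posQuad) (hF : DifferentiableAt ℝ F η) (hpos : 0 < F η) :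
    fderiv ℝ (PhiCrit γ F) η = 0 ↔
      (2 + γ) * (η.1 * dF1 F η) = F η ∧ (2 + γ) * (η.2 * dF2 F η) = F η := by
  obtain ⟨h₁, h₂⟩ := hη
  have hc : 0 < γ ^ γ / (γ + 2) ^ (γ + 2) := by positivity
  have hmul : HasFDerivAt (fun p : ℝ × ℝ => p.1 * p.2) _ η :=
    (hasFDerivAt_fst (𝕜 := ℝ) (p := η)).mul (hasFDerivAt_snd (𝕜 := ℝ) (p := η))
  have hinv := (hasDerivAt_inv (mul_pos h₁ h₂).ne').comp_hasFDerivAt η hmul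
  have hpow := (hF.hasFDerivAt.rpow_const (p := 2 + γ) (Or.inl hpos.ne')).const_mul
    (γ ^ γ / (γ + 2) ^ (γ + 2))
  have hΦ : HasFDerivAt (PhiCrit γ F) _ η := hpow.mul hinv
  have hD₁ : fderiv ℝ F η (1, 0) = dF1 F η := rfl
  have hD₂ : fderiv ℝ F η (0, 1) = dF2 F η := rfl
  have hexp : F η ^ (2 + γ) = F η ^ (2 + γ - 1) * F η := by
    rw [← Real.rpow_add_one hpos.ne']
    ring_nf
  have hG : 0 < F η ^ (2 + γ - 1) := Real.rpow_pos_of_pos hpos _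
  rw [hΦ.fderiv, clm_prod_eq_zero_iff]
  simp only [add_apply, smul_apply,
    ContinuousLinearMap.coe_fst', ContinuousLinearMap.coe_snd', smul_eq_mul,
    hD₁, hD₂, hexp]
  generalize γ ^ γ / (γ + 2) ^ (γ + 2) = c at hc
  generalize F η ^ (2 + γ - 1) = G at hG
  have hne₁ := h₁.ne'
  have hne₂ := h₂.ne'
  refine and_congr ?_ ?_
  · have hk : c * G / (η.1 ^ 2 * η.2) ≠ 0 := by positivity
    refine (Eq.congr_left ?_).trans ((mul_eq_zero_iff_left hk).trans sub_eq_zero)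
    field_simp
    ring
  · have hk : c * G / (η.1 * η.2 ^ 2) ≠ 0 := by positivity
    refine (Eq.congr_left ?_).trans ((mul_eq_zero_iff_left hk).trans sub_eq_zero)
    field_simp
    ring

theorem fderiv_PsiCrit_eq_zero_iff {γ : ℝ} {F : ℝ × ℝ → ℝ} {η : ℝ × ℝ}
    (hF : DifferentiableAt ℝ F η) (hF₁ : DifferentiableAt ℝ (dF1 F) η)
    (hF₂ : DifferentiableAt ℝ (dF2 F) η) (hd1 : 0 < dF1 F η) (hd2 : 0 < dF2 F η)
    (hres : 0 < F η - (η.1 * dF1 F η + η.2 * dF2 F η))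
    (hHess : (fderiv ℝ (dF1 F) η (1, 0)) * (fderiv ℝ (dF2 F) η (0, 1)) -
        (fderiv ℝ (dF1 F) η (0, 1)) * (fderiv ℝ (dF2 F) η (1, 0)) ≠ 0) :
    fderiv ℝ (PsiCrit γ F) η = 0 ↔
      (γ * η.1 * dF1 F η = F η - (η.1 * dF1 F η + η.2 * dF2 F η) ∧
        γ * η.2 * dF2 F η = F η - (η.1 * dF1 F η + η.2 * dF2 F η)) := by
  have hR : HasFDerivAt (fun p : ℝ × ℝ => F p - (p.1 * dF1 F p + p.2 * dF2 F p)) _ η :=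
    hF.hasFDerivAt.sub (((hasFDerivAt_fst (p := η)).mul hF₁.hasFDerivAt).add
      ((hasFDerivAt_snd (p := η)).mul hF₂.hasFDerivAt))
  have hΨ : HasFDerivAt (PsiCrit γ F) _ η :=
    ((hR.rpow_const (p := γ) (Or.inl hres.ne')).mul hF₁.hasFDerivAt).mul hF₂.hasFDerivAt
  have hD₁ : fderiv ℝ F η (1, 0) = dF1 F η := rfl
  have hD₂ : fderiv ℝ F η (0, 1) = dF2 F η := rfl
  have hexp : (F η - (η.1 * dF1 F η + η.2 * dF2 F η)) ^ γ =
      (F η - (η.1 * dF1 F η + η.2 * dF2 F η)) ^ (γ - 1) *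
        (F η - (η.1 * dF1 F η + η.2 * dF2 F η)) := by
    rw [← Real.rpow_add_one hres.ne']
    ring_nf
  have hG : 0 < (F η - (η.1 * dF1 F η + η.2 * dF2 F η)) ^ (γ - 1) := Real.rpow_pos_of_pos hres _
  rw [hΨ.fderiv, clm_prod_eq_zero_iff]
  simp only [add_apply, sub_apply,
    smul_apply, ContinuousLinearMap.coe_fst', ContinuousLinearMap.coe_snd',
    smul_eq_mul, Pi.mul_apply, hD₁, hD₂, hexp]
  generalize (F η - (η.1 * dF1 F η + η.2 * dF2 F η)) ^ (γ - 1) = G at hG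
  generalize fderiv ℝ (dF1 F) η (1, 0) = a₁ at *
  generalize fderiv ℝ (dF1 F) η (0, 1) = a₂ at *
  generalize fderiv ℝ (dF2 F) η (1, 0) = b₁ at *
  generalize fderiv ℝ (dF2 F) η (0, 1) = b₂ at *
  generalize dF1 F η = a at *
  generalize dF2 F η = b at *
  set R := F η - (η.1 * a + η.2 * b) with hRdef
  constructor
  · rintro ⟨e₁, e₂⟩
    have k₁ : b * (R - γ * η.1 * a) * a₁ + a * (R - γ * η.2 * b) * b₁ = 0 := by
      refine (mul_eq_zero_iff_left hG.ne').1 ?_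
      linear_combination e₁
    have k₂ : b * (R - γ * η.1 * a) * a₂ + a * (R - γ * η.2 * b) * b₂ = 0 := by
      refine (mul_eq_zero_iff_left hG.ne').1 ?_
      linear_combination e₂
    have m₁ : (b * (a₁ * b₂ - a₂ * b₁)) * (R - γ * η.1 * a) = 0 := by
      linear_combination b₂ * k₁ - b₁ * k₂
    have m₂ : (a * (a₁ * b₂ - a₂ * b₁)) * (R - γ * η.2 * b) = 0 := by
      linear_combination a₁ * k₂ - a₂ * k₁
    have n₁ := (mul_eq_zero_iff_left (mul_ne_zero hd2.ne' hHess)).1 m₁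
    have n₂ := (mul_eq_zero_iff_left (mul_ne_zero hd1.ne' hHess)).1 m₂
    exact ⟨(sub_eq_zero.1 n₁).symm, (sub_eq_zero.1 n₂).symm⟩
  · rintro ⟨e₁, e₂⟩
    constructor
    · linear_combination -G * b * a₁ * e₁ - G * a * b₁ * e₂
    · linear_combination -G * b * a₂ * e₁ - G * a * b₂ * e₂

/-- if `F` is `C²` on the positive quadrant with positive value, positive
partial derivatives, positive residual `F − η·∇F` and nonsingular Hessian, then the
criteria `Φ_γ` and `Ψ_γ` have the same critical points, namely the solutions of the
balancing system `γη₁∂₁F(η) = γη₂∂₂F(η) = F(η) − η·∇F(η)`. -/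
theorem balancing_criteria_same_critical_points
    (γ : ℝ) (hγ : 0 < γ) (F : ℝ × ℝ → ℝ)
    (hF : ContDiffOn ℝ 2 F posQuad)
    (hFpos : ∀ p ∈ posQuad, 0 < F p)
    (hd1 : ∀ p ∈ posQuad, 0 < dF1 F p)
    (hd2 : ∀ p ∈ posQuad, 0 < dF2 F p)
    (hres : ∀ p ∈ posQuad, 0 < F p - (p.1 * dF1 F p + p.2 * dF2 F p))
    (hHess : ∀ p ∈ posQuad,
      (fderiv ℝ (dF1 F) p (1, 0)) * (fderiv ℝ (dF2 F) p (0, 1)) -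
        (fderiv ℝ (dF1 F) p (0, 1)) * (fderiv ℝ (dF2 F) p (1, 0)) ≠ 0)
    (η : ℝ × ℝ) (hη : η ∈ posQuad) :
    (fderiv ℝ (PhiCrit γ F) η = 0 ↔
      (γ * η.1 * dF1 F η = F η - (η.1 * dF1 F η + η.2 * dF2 F η) ∧
        γ * η.2 * dF2 F η = F η - (η.1 * dF1 F η + η.2 * dF2 F η))) ∧
    (fderiv ℝ (PsiCrit γ F) η = 0 ↔
      (γ * η.1 * dF1 F η = F η - (η.1 * dF1 F η + η.2 * dF2 F η) ∧
        γ * η.2 * dF2 F η = F η - (η.1 * dF1 F η + η.2 * dF2 F η))) := by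
  have hnhds : posQuad ∈ 𝓝 η := isOpen_posQuad.mem_nhds hη
  have hFat : ContDiffAt ℝ 2 F η := hF.contDiffAt hnhds
  have hdiff : DifferentiableAt ℝ F η := hFat.differentiableAt (by norm_num)
  have hfderiv : DifferentiableAt ℝ (fderiv ℝ F) η :=
    (hFat.fderiv_right (m := 1) (by norm_num)).differentiableAt (by norm_num)
  refine ⟨(fderiv_PhiCrit_eq_zero_iff hγ hη hdiff (hFpos η hη)).trans ?_,
    fderiv_PsiCrit_eq_zero_iff hdiff (hfderiv.clm_apply (differentiableAt_const _))
      (hfderiv.clm_apply (differentiableAt_const _)) (hd1 η hη) (hd2 η hη) (hres η hη)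
      (hHess η hη)⟩
  constructor
  · rintro ⟨e₁, e₂⟩
    have e : η.1 * dF1 F η = η.2 * dF2 F η :=
      mul_left_cancel₀ (by positivity : 2 + γ ≠ 0) (e₁.trans e₂.symm)
    constructor
    · linear_combination e₁ - e
    · linear_combination e₂ + e
  · rintro ⟨e₁, e₂⟩
    have e : η.1 * dF1 F η = η.2 * dF2 F η :=
      mul_left_cancel₀ hγ.ne' (by linear_combination e₁ - e₂)
    constructor
    · linear_combination e₁ + e
    · linear_combination e₂ - e
end
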